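/- Let x, y, z ∈ ℝ² be affinely independent, and let v₁, v₂ be points of the open segment (y,z) with v₁ ≠ v₂ and v₁ lying on the closed segment [y,v₂]. Let S be a finite set of points contained in the open triangle △xyz such that no point of S lies on the closed segment [x,v₁] or on the closed segment [x,v₂]. Then N_S(△xv₁y) + N_S(△xv₁v₂) + N_S(△xv₂z) = |S|. -/

import Mathlib

open scoped Classical

/-- Number of points of `S` strictly inside the triangle with vertices `a`, `b`, `c`
(the interior of the convex hull of `{a, b, c}`). -/
noncomputable def NTri (S : Finset (ℝ × ℝ)) (a b c : ℝ × ℝ) : ℕ :=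
  (S.filter (fun p => p ∈ interior (convexHull ℝ ({a, b, c} : Set (ℝ × ℝ))))).card

/-- A set of points in the plane is in general position if no three distinct
points of it are collinear. -/
def GenPos (P : Set (ℝ × ℝ)) : Prop :=
  ∀ p ∈ P, ∀ q ∈ P, ∀ r ∈ P,
    p ≠ q → p ≠ r → q ≠ r → ¬ Collinear ℝ ({p, q, r} : Set (ℝ × ℝ))

open AffineMap (lineMap)

theorem affineIndependent_three_iff_forall {E : Type*} [AddCommGroup E] [Module ℝ E] {a b c : E} :
    AffineIndependent ℝ ![a, b, c] ↔
      ∀ s t : ℝ, s • (b - a) + t • (c - a) = 0 → s = 0 ∧ t = 0 := by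
  rw [affineIndependent_iff_linearIndependent_vsub ℝ _ (0 : Fin 3),
    ← linearIndependent_equiv (finSuccAboveEquiv (0 : Fin 3)), ← LinearIndependent.pair_iff]
  apply iff_of_eq
  congr 1
  ext i
  fin_cases i <;> rfl

theorem mem_interior_triangle_iff {a b c : ℝ × ℝ} (h : AffineIndependent ℝ ![a, b, c])
    {α β γ : ℝ} (hsum : α + β + γ = 1) :
    α • a + β • b + γ • c ∈ interior (convexHull ℝ ({a, b, c} : Set (ℝ × ℝ))) ↔
      0 < α ∧ 0 < β ∧ 0 < γ := by
  have htop : affineSpan ℝ (Set.range ![a, b, c]) = ⊤ :=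
    h.affineSpan_eq_top_iff_card_eq_finrank_add_one.2 (by simp)
  let B : AffineBasis (Fin 3) ℝ (ℝ × ℝ) := ⟨![a, b, c], h, htop⟩
  have hrange : Set.range B = {a, b, c} := by
    change Set.range ![a, b, c] = _
    simp only [Matrix.range_cons, Matrix.range_empty, Set.union_empty, Set.singleton_union]
  have hw : ∑ i, ![α, β, γ] i = 1 := by simp [Fin.sum_univ_three, hsum]
  have hp : α • a + β • b + γ • c = Finset.univ.affineCombination ℝ B ![α, β, γ] := by
    rw [Finset.affineCombination_eq_linear_combination _ _ _ hw]
    simp [Fin.sum_univ_three, B, DFunLike.coe]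
  rw [← hrange, B.interior_convexHull, hp]
  simp [B.coord_apply_combination_of_mem (Finset.mem_univ _) hw, Fin.forall_fin_succ]

theorem AffineIndependent.triangle_lineMap {E : Type*} [AddCommGroup E] [Module ℝ E] {x y z : E}
    (h : AffineIndependent ℝ ![x, y, z]) {s t : ℝ} (hst : s ≠ t) :
    AffineIndependent ℝ ![x, lineMap y z s, lineMap y z t] := by
  rw [affineIndependent_three_iff_forall] at h ⊢
  intro α β hαβ
  obtain ⟨h₁, h₂⟩ := h (α * (1 - s) + β * (1 - t)) (α * s + β * t) (by
    rw [← hαβ]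
    simp only [AffineMap.lineMap_apply_module]
    module)
  have hα : α * (s - t) = 0 := by linear_combination h₂ - t * (h₁ + h₂)
  have hα' : α = 0 := (mul_eq_zero.1 hα).resolve_right (sub_ne_zero.2 hst)
  subst hα'
  exact ⟨rfl, by linarith⟩

/-- Points of an open triangle with apex `x`, in terms of the parameter of their central projection
from `x` to the opposite side. -/
theorem lineMap_lineMap_mem_interior_iff {x y z : ℝ × ℝ} (h : AffineIndependent ℝ ![x, y, z])
    {s t q r : ℝ} (hst : s < t) (hr₀ : 0 < r) (hr₁ : r < 1) :
    lineMap x (lineMap y z q) r ∈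
        interior (convexHull ℝ ({x, lineMap y z s, lineMap y z t} : Set (ℝ × ℝ))) ↔
      s < q ∧ q < t := by
  have hd : 0 < t - s := sub_pos.2 hst
  have hp : lineMap x (lineMap y z q) r = (1 - r) • x + (r * ((t - q) / (t - s))) • lineMap y z s +
      (r * ((q - s) / (t - s))) • lineMap y z t := by
    simp only [AffineMap.lineMap_apply_module]
    match_scalars <;> field_simp <;> ring
  rw [hp, mem_interior_triangle_iff (h.triangle_lineMap hst.ne) (by field_simp; ring),
    mul_pos_iff_of_pos_left hr₀, mul_pos_iff_of_pos_left hr₀, div_pos_iff_of_pos_right hd,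
    div_pos_iff_of_pos_right hd, sub_pos, sub_pos, sub_pos]
  tauto

theorem exists_lineMap_lineMap_of_mem_interior {x y z p : ℝ × ℝ}
    (h : AffineIndependent ℝ ![x, y, z])
    (hp : p ∈ interior (convexHull ℝ ({x, y, z} : Set (ℝ × ℝ)))) :
    ∃ q r : ℝ, 0 < q ∧ q < 1 ∧ 0 < r ∧ r < 1 ∧ lineMap x (lineMap y z q) r = p := by
  obtain ⟨α, β, γ, hsum, rfl⟩ : ∃ α β γ : ℝ, α + β + γ = 1 ∧ α • x + β • y + γ • z = p := by
    have hmem := interior_subset hp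
    rw [convexHull_insert (by simp), convexHull_pair, mem_convexJoin] at hmem
    obtain ⟨a, ha, b, ⟨c, d, -, -, hcd, rfl⟩, e, f, -, -, hef, rfl⟩ := hmem
    rw [Set.mem_singleton_iff.1 ha]
    exact ⟨e, f * c, f * d, by linear_combination hef + f * hcd, by module⟩
  obtain ⟨hα, hβ, hγ⟩ := (mem_interior_triangle_iff h hsum).1 hp
  have hβγ : 0 < β + γ := by positivity
  refine ⟨γ / (β + γ), β + γ, by positivity, (div_lt_one hβγ).2 (by linarith), hβγ, by linarith, ?_⟩
  obtain rfl : α = 1 - (β + γ) := by linarith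
  simp only [AffineMap.lineMap_apply_module]
  match_scalars <;> field_simp
  ring

/-- Counting identity along the base: if `v₁, v₂` lie on the open segment `(y,z)`
with `v₁` between `y` and `v₂`, and no point of `S` lies on `[x,v₁]` or `[x,v₂]`,
then `N_S(△xv₁y) + N_S(△xv₁v₂) + N_S(△xv₂z) = |S|`. -/
theorem stmt4 (x y z : ℝ × ℝ) (hxyz : AffineIndependent ℝ ![x, y, z])
    (v₁ v₂ : ℝ × ℝ) (hv₁ : v₁ ∈ openSegment ℝ y z) (hv₂ : v₂ ∈ openSegment ℝ y z)
    (hne : v₁ ≠ v₂) (horder : v₁ ∈ segment ℝ y v₂)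
    (S : Finset (ℝ × ℝ))
    (hS : ∀ p ∈ S, p ∈ interior (convexHull ℝ ({x, y, z} : Set (ℝ × ℝ))))
    (hseg : ∀ p ∈ S, p ∉ segment ℝ x v₁ ∧ p ∉ segment ℝ x v₂) :
    NTri S x v₁ y + NTri S x v₁ v₂ + NTri S x v₂ z = S.card := by
  obtain ⟨s, ⟨hs₀, -⟩, rfl⟩ := (openSegment_eq_image_lineMap ℝ y z) ▸ hv₁
  obtain ⟨t, ⟨ht₀, ht₁⟩, rfl⟩ := (openSegment_eq_image_lineMap ℝ y z) ▸ hv₂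
  have hst : s < t := by
    have hyz : y ≠ z := hxyz.injective.ne (show (1 : Fin 3) ≠ 2 by decide)
    have hne' : s ≠ t := fun hst => hne (by rw [hst])
    obtain ⟨r, ⟨hr₀, hr₁⟩, hr⟩ := (segment_eq_image_lineMap ℝ y (lineMap y z t)) ▸ horder
    have hrt : lineMap y z (r * t) = lineMap y z s := by
      rw [← hr]
      simp only [AffineMap.lineMap_apply_module]
      module
    have hrt' : r * t = s := AffineMap.lineMap_injective ℝ hyz hrt
    exact lt_of_le_of_ne (hrt' ▸ mul_le_of_le_one_left ht₀.le hr₁) hne'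
  simp only [NTri, Finset.card_filter, Finset.card_eq_sum_ones S, ← Finset.sum_add_distrib]
  refine Finset.sum_congr rfl fun p hp => ?_
  obtain ⟨q, r, hq₀, hq₁, hr₀, hr₁, rfl⟩ := exists_lineMap_lineMap_of_mem_interior hxyz (hS p hp)
  have hseg_mem : lineMap x (lineMap y z q) r ∈ segment ℝ x (lineMap y z q) := by
    rw [segment_eq_image_lineMap]
    exact ⟨r, ⟨hr₀.le, hr₁.le⟩, rfl⟩
  have hqs : q ≠ s := by
    rintro rfl
    exact (hseg _ hp).1 hseg_mem
  have hqt : q ≠ t := by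
    rintro rfl
    exact (hseg _ hp).2 hseg_mem
  have h₁ := lineMap_lineMap_mem_interior_iff (q := q) hxyz hs₀ hr₀ hr₁
  have h₂ := lineMap_lineMap_mem_interior_iff (q := q) hxyz hst hr₀ hr₁
  have h₃ := lineMap_lineMap_mem_interior_iff (q := q) hxyz ht₁ hr₀ hr₁
  rw [AffineMap.lineMap_apply_zero, Set.pair_comm] at h₁
  rw [AffineMap.lineMap_apply_one] at h₃
  simp only [h₁, h₂, h₃]
  grind
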